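/- The Galois group of the splitting field over ℚ of the polynomial x⁶ + 2x⁵ + 5x⁴ + 10x³ + 10x² + 8x + 1 is non-abelian of order 60. -/

import Mathlib

open Polynomial

set_option maxHeartbeats 4000000 in
theorem resolvent_relation {L : Type*} [CommRing L] (a b c d e E A B M D t : L)
    (h1 : e = -(a + b + c + d))
    (r1 : a^2 + a*b + a*c + a*d + b^2 + b*c + b*d + c^2 + c*d + d^2 = 0)
    (r2 : a^3 + a^2*b + a^2*c + a*b^2 + a*b*c + a*c^2 + b^3 + b^2*c + b*c^2 + c^3 = 0)
    (hE : E = a*b*c*d+a*b*c*e+a*b*d*e+a*c*d*e+b*c*d*e)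
    (hA : A = (b-a)*(d-a)*(e-a)) (hB : B = (c-b)*(d-b)*(e-b))
    (hM : M = (c-a)*(d-c)*(e-c)*(e-d)) (hD : D = A*B*M)
    (ht : t = a*b+b*c+c*d+d*e+e*a) :
    t^6 - 5*E*t^4 + 15*E^2*t^2 - D*t + 5*E^3 = 0 := by
  subst h1
  have t1 : t =
      a*b - a*d + b^2 + 2*b*c + c^2 + c*d := by
    linear_combination ht +
      (-1) * r1 +
      (0) * r2
  have t2 : t^2 =
      -2*a^4 - 5*a^3*b - 2*a^3*d - 4*a^2*b^2 - 3*a^2*b*c - 4*a^2*b*d - a^2*c^2 - 2*a*b^3 +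
      2*a*b^2*c - 3*a*b^2*d - a*b*c^2 - a*b*c*d - 2*a*c^2*d - 2*b^4 + b^3*c - b^3*d + 2*b^2*c^2
      + b^2*c*d + 2*b*c^2*d := by
    linear_combination (t + (a*b - a*d + b^2 + 2*b*c + c^2 + c*d)) * t1 +
      (a^2 - 2*a*c + c^2) * r1 +
      (a + 3*b + d) * r2
  have t3 : t^3 =
      -5*a^6 - 11*a^5*b + a^5*d - 22*a^4*b^2 - 7*a^4*b*c + a^4*b*d - 6*a^4*c^2 - a^4*c*d -
      27*a^3*b^3 - 17*a^3*b^2*c - 9*a^3*b^2*d - 6*a^3*b*c^2 - a^3*b*c*d - 17*a^2*b^4 -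
      12*a^2*b^3*c - 9*a^2*b^3*d - 11*a^2*b^2*c^2 - 11*a^2*b^2*c*d - 12*a*b^5 - 7*a*b^4*c -
      4*a*b^4*d - a*b^3*c^2 - 6*a*b^3*c*d - 6*b^6 - 7*b^5*c - 5*b^5*d - b^4*c^2 - 6*b^4*c*d := by
    linear_combination t^2 * t1 + (a*b - a*d + b^2 + 2*b*c + c^2 + c*d) * t2 +
      (2*a^4 + 4*a^3*b - 2*a^3*c + 3*a^2*b^2 - 3*a^2*b*c + 2*a^2*c^2 + a*b^3 - 4*a*b^2*c -
      3*a*b*c^2 - 2*a*c^3 - b^3*c + b^2*c^2 + 2*b*c^3) * r1 +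
      (3*a^3 - 3*a^2*c - a^2*d + 3*a*b^2 + 2*a*b*c - 3*a*b*d + 2*a*c^2 + 4*b^3 + b^2*c + 4*b^2*d
      - 2*b*c^2) * r2
  have k1 : E =
      -a^4 - a^3*b - a^2*b^2 - a*b^3 - b^4 := by
    linear_combination hE +
      (-a*b - a*c - b*c) * r1 +
      (a + b) * r2
  have k2 : E^2 =
      a^8 + 2*a^7*b + 3*a^6*b^2 + 4*a^5*b^3 + 5*a^4*b^4 + 4*a^3*b^5 + 3*a^2*b^6 + 2*a*b^7 + b^8 := by
    linear_combination (E + (-a^4 - a^3*b - a^2*b^2 - a*b^3 - b^4)) * k1 +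
      (0) * r1 +
      (0) * r2
  have d1 : A =
      -3*a^3 + a^2*b - 2*a^2*c + a*b^2 + a*b*c - a*c^2 + b^3 + b^2*c + b*c^2 := by
    linear_combination hA +
      (a - b) * r1 +
      (0) * r2
  have d2 : B =
      -a^3 - 2*a^2*b - 3*a*b^2 - 4*b^3 := by
    linear_combination hB +
      (b - c) * r1 +
      (1) * r2
  have d3 : M =
      3*a^3*b + 4*a^3*c + 8*a^3*d + 3*a^2*b^2 + 7*a^2*b*c + 8*a^2*b*d + 4*a^2*c^2 + 8*a^2*c*d +
      2*a*b^3 + 5*a*b^2*c + 8*a*b^2*d + 4*a*b*c^2 + 8*a*b*c*d + 8*a*c^2*d + 2*b^4 + 4*b^3*c +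
      6*b^3*d + 2*b^2*c^2 + 4*b^2*c*d + 2*b*c^2*d := by
    linear_combination hM +
      (-a^2 - a*b - 2*a*d + b*c + c^2 + 2*c*d) * r1 +
      (a - 2*b - 3*c - 6*d) * r2
  have d12 : A*B =
      3*a^6 + 5*a^5*b + 2*a^5*c + 6*a^4*b^2 + 3*a^4*b*c + a^4*c^2 + 6*a^3*b^3 + 3*a^3*b^2*c +
      a^3*b*c^2 - 9*a^2*b^4 + 3*a^2*b^3*c + a^2*b^2*c^2 - 7*a*b^5 - 7*a*b^4*c + a*b^3*c^2 -
      4*b^6 - 4*b^5*c - 4*b^4*c^2 := by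
    linear_combination B * d1 + (-3*a^3 + a^2*b - 2*a^2*c + a*b^2 + a*b*c - a*c^2 + b^3 + b^2*c + b*c^2) * d2 +
      (0) * r1 +
      (0) * r2
  have dd : D =
      -8*a^10 - 18*a^9*b + 8*a^9*d - 29*a^8*b^2 + 8*a^8*b*c + 22*a^8*b*d + 8*a^8*c^2 +
      16*a^8*c*d - 44*a^7*b^3 + 14*a^7*b^2*c + 40*a^7*b^2*d + 22*a^7*b*c^2 + 44*a^7*b*c*d +
      24*a^7*c^2*d - 13*a^6*b^4 + 18*a^6*b^3*c + 52*a^6*b^3*d + 32*a^6*b^2*c^2 + 64*a^6*b^2*c*d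
      + 42*a^6*b*c^2*d + 20*a^5*b^4*c + 18*a^5*b^4*d + 38*a^5*b^3*c^2 + 76*a^5*b^3*c*d +
      54*a^5*b^2*c^2*d + 13*a^4*b^6 - 20*a^4*b^5*c - 18*a^4*b^5*d + 60*a^4*b^3*c^2*d +
      44*a^3*b^7 - 18*a^3*b^6*c - 52*a^3*b^6*d - 38*a^3*b^5*c^2 - 76*a^3*b^5*c*d -
      60*a^3*b^4*c^2*d + 29*a^2*b^8 - 14*a^2*b^7*c - 40*a^2*b^7*d - 32*a^2*b^6*c^2 -
      64*a^2*b^6*c*d - 54*a^2*b^5*c^2*d + 18*a*b^9 - 8*a*b^8*c - 22*a*b^8*d - 22*a*b^7*c^2 -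
      44*a*b^7*c*d - 42*a*b^6*c^2*d + 8*b^10 - 8*b^9*d - 8*b^8*c^2 - 16*b^8*c*d - 24*b^7*c^2*d := by
    linear_combination hD + M * d12 + (3*a^6 + 5*a^5*b + 2*a^5*c + 6*a^4*b^2 + 3*a^4*b*c + a^4*c^2 + 6*a^3*b^3 + 3*a^3*b^2*c + a^3*b*c^2 - 9*a^2*b^4 + 3*a^2*b^3*c + a^2*b^2*c^2 - 7*a*b^5 - 7*a*b^4*c + a*b^3*c^2 - 4*b^6 - 4*b^5*c - 4*b^4*c^2) * d3 +
      (0) * r1 +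
      (8*a^7 + 19*a^6*b + 4*a^6*c + 16*a^6*d + 26*a^5*b^2 + 8*a^5*b*c + 26*a^5*b*d + 8*a^5*c*d +
      30*a^4*b^3 + 10*a^4*b^2*c + 30*a^4*b^2*d + 10*a^4*b*c*d - 10*a^3*b^4 + 10*a^3*b^3*c +
      30*a^3*b^3*d + 10*a^3*b^2*c*d - 33*a^2*b^5 - 10*a^2*b^4*c - 50*a^2*b^4*d + 10*a^2*b^3*c*d
      - 24*a*b^6 - 14*a*b^5*c - 36*a*b^5*d - 30*a*b^4*c*d - 16*b^7 - 8*b^6*c - 16*b^6*d -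
      8*b^5*c*d) * r2
  have u1 : E^2 - t^4 + 3*E*t^2 =
      10*a^8 + 21*a^7*b - 6*a^7*d + 40*a^6*b^2 + 6*a^6*b*c - 8*a^6*b*d + 7*a^6*c^2 + 55*a^5*b^3
      + 17*a^5*b^2*c - 12*a^5*b^2*d + 9*a^5*b*c^2 - 3*a^5*b*c*d - 6*a^5*c^2*d + 70*a^4*b^4 +
      40*a^4*b^3*c + 5*a^4*b^3*d + 15*a^4*b^2*c^2 - 5*a^4*b^2*c*d - 10*a^4*b*c^2*d + 60*a^3*b^5
      + 60*a^3*b^4*c + 25*a^3*b^4*d + 35*a^3*b^3*c^2 + 35*a^3*b^3*c*d - 10*a^3*b^2*c^2*d +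
      34*a^2*b^6 + 35*a^2*b^5*c + 21*a^2*b^5*d + 15*a^2*b^4*c^2 + 35*a^2*b^4*c*d +
      10*a^2*b^3*c^2*d + 25*a*b^7 + 29*a*b^6*c + 18*a*b^6*d + 13*a*b^5*c^2 + 25*a*b^5*c*d +
      10*a*b^4*c^2*d + 10*b^8 + 13*b^7*c + 7*b^7*d + 6*b^6*c^2 + 13*b^6*c*d + 6*b^5*c^2*d := by
    linear_combination k2 - (t^2 + (-2*a^4 - 5*a^3*b - 2*a^3*d - 4*a^2*b^2 - 3*a^2*b*c - 4*a^2*b*d - a^2*c^2 - 2*a*b^3 + 2*a*b^2*c - 3*a*b^2*d - a*b*c^2 - a*b*c*d - 2*a*c^2*d - 2*b^4 + b^3*c - b^3*d + 2*b^2*c^2 + b^2*c*d + 2*b*c^2*d)) * t2 + 3*t^2 * k1 + 3*(-a^4 - a^3*b - a^2*b^2 - a*b^3 - b^4) * t2 +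
      (-4*a^6 - 16*a^5*b - 28*a^4*b^2 - 4*a^4*b*c - 8*a^4*c^2 - 28*a^3*b^3 - 4*a^3*b^2*c -
      8*a^3*b*c^2 - 17*a^2*b^4 + 2*a^2*b^3*c + 3*a^2*b^2*c^2 - 4*a^2*b*c^3 - 4*a^2*c^4 - 6*a*b^5
      + 4*a*b^4*c + 10*a*b^3*c^2 + 8*a*b^2*c^3 + 8*a*b*c^4 - b^6 + 2*b^5*c + 3*b^4*c^2 -
      4*b^3*c^3 - 4*b^2*c^4) * r1 +
      (-3*a^5 + 5*a^4*b + 7*a^4*c + 8*a^4*d + a^3*b^2 + 6*a^3*b*c + 2*a^3*b*d - 4*a^3*c*d +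
      9*a^2*b^3 + 5*a^2*b^2*d + 4*a^2*b*c^2 + 4*a^2*b*c*d + 4*a^2*c^3 + 4*a^2*c^2*d - 6*a*b^4 -
      6*a*b^3*c - 8*a*b^3*d - 8*a*b^2*c^2 + 4*a*b^2*c*d - 8*a*b*c^3 - 8*a*b*c^2*d - 6*b^5 -
      7*b^4*c - 7*b^4*d + 4*b^3*c^2 - 4*b^3*c*d + 4*b^2*c^3 + 4*b^2*c^2*d) * r2
  have w1 : t^6 =
      58*a^12 + 161*a^11*b - 22*a^11*d + 355*a^10*b^2 + 22*a^10*b*c - 68*a^10*b*d + 59*a^10*c^2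
      + 617*a^9*b^3 + 101*a^9*b^2*c - 137*a^9*b^2*d + 142*a^9*b*c^2 - 11*a^9*b*c*d -
      22*a^9*c^2*d + 897*a^8*b^4 + 281*a^8*b^3*c - 127*a^8*b^3*d + 272*a^8*b^2*c^2 -
      21*a^8*b^2*c*d - 42*a^8*b*c^2*d + 1161*a^7*b^5 + 551*a^7*b^4*c - 77*a^7*b^4*d +
      492*a^7*b^3*c^2 + 149*a^7*b^3*c*d - 62*a^7*b^2*c^2*d + 1230*a^6*b^6 + 746*a^6*b^5*c +
      97*a^6*b^5*d + 472*a^6*b^4*c^2 + 319*a^6*b^4*c*d + 8*a^6*b^3*c^2*d + 1187*a^5*b^7 +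
      847*a^5*b^6*c + 234*a^5*b^6*d + 419*a^5*b^5*c^2 + 419*a^5*b^5*c*d + 28*a^5*b^4*c^2*d +
      1058*a^4*b^8 + 899*a^4*b^7*c + 362*a^4*b^7*d + 283*a^4*b^6*c^2 + 436*a^4*b^6*c*d -
      28*a^4*b^5*c^2*d + 728*a^3*b^9 + 769*a^3*b^8*c + 452*a^3*b^8*d + 203*a^3*b^7*c^2 +
      546*a^3*b^7*c*d - 8*a^3*b^6*c^2*d + 406*a^2*b^10 + 449*a^2*b^9*c + 302*a^2*b^9*d +
      83*a^2*b^8*c^2 + 376*a^2*b^8*c*d + 62*a^2*b^7*c^2*d + 209*a*b^11 + 254*a*b^10*c +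
      175*a*b^10*d + 53*a*b^9*c^2 + 206*a*b^9*c*d + 42*a*b^8*c^2*d + 58*b^12 + 81*b^11*c +
      59*b^11*d + 22*b^10*c^2 + 81*b^10*c*d + 22*b^9*c^2*d := by
    linear_combination (t^3 + (-5*a^6 - 11*a^5*b + a^5*d - 22*a^4*b^2 - 7*a^4*b*c + a^4*b*d - 6*a^4*c^2 - a^4*c*d - 27*a^3*b^3 - 17*a^3*b^2*c - 9*a^3*b^2*d - 6*a^3*b*c^2 - a^3*b*c*d - 17*a^2*b^4 - 12*a^2*b^3*c - 9*a^2*b^3*d - 11*a^2*b^2*c^2 - 11*a^2*b^2*c*d - 12*a*b^5 - 7*a*b^4*c - 4*a*b^4*d - a*b^3*c^2 - 6*a*b^3*c*d - 6*b^6 - 7*b^5*c - 5*b^5*d - b^4*c^2 - 6*b^4*c*d)) * t3 +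
      (a^10 + 2*a^9*b - 2*a^9*c - 17*a^8*b^2 - 4*a^8*b*c + a^8*c^2 - 36*a^7*b^3 - 6*a^7*b^2*c +
      2*a^7*b*c^2 + 55*a^6*b^4 + 2*a^6*b^3*c + 23*a^6*b^2*c^2 + 144*a^5*b^5 + 200*a^5*b^4*c +
      34*a^5*b^3*c^2 + 143*a^4*b^6 + 312*a^4*b^5*c + 145*a^4*b^4*c^2 + 162*a^3*b^7 +
      314*a^3*b^6*c + 144*a^3*b^5*c^2 + 106*a^2*b^8 + 266*a^2*b^7*c + 168*a^2*b^6*c^2 + 40*a*b^9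
      + 108*a*b^8*c + 72*a*b^7*c^2 + 25*b^10 + 60*b^9*c + 36*b^8*c^2) * r1 +
      (-34*a^9 - 20*a^8*b + 35*a^8*c + 11*a^8*d + 54*a^7*b^2 + 70*a^7*b*c + 22*a^7*b*d +
      188*a^6*b^3 + 145*a^6*b^2*c + 143*a^6*b^2*d + 127*a^5*b^4 + 110*a^5*b^3*c + 194*a^5*b^3*d
      - 11*a^4*b^5 + 245*a^4*b^4*d - 75*a^3*b^6 - 110*a^3*b^5*c + 84*a^3*b^5*d - 99*a^2*b^7 -
      145*a^2*b^6*c - 2*a^2*b^6*d - 83*a*b^8 - 70*a*b^7*c - 48*a*b^7*d - 47*b^9 - 35*b^8*c -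
      24*b^8*d) * r2
  have x1 : D*t =
      8*a^12 + 6*a^11*b + 8*a^11*d - 8*a^10*b*c + 2*a^10*b*d + 24*a^10*c^2 - 13*a^9*b^3 -
      14*a^9*b^2*c - 7*a^9*b^2*d + 62*a^9*b*c^2 + 4*a^9*b*c*d + 8*a^9*c^2*d - 83*a^8*b^4 -
      34*a^8*b^3*c - 22*a^8*b^3*d + 117*a^8*b^2*c^2 + 19*a^8*b^2*c*d + 38*a^8*b*c^2*d -
      69*a^7*b^5 - 64*a^7*b^4*c - 97*a^7*b^4*d + 162*a^7*b^3*c^2 + 14*a^7*b^3*c*d +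
      68*a^7*b^2*c^2*d - 65*a^6*b^6 - 44*a^6*b^5*c - 58*a^6*b^5*d + 67*a^6*b^4*c^2 +
      9*a^6*b^4*c*d + 88*a^6*b^3*c^2*d - 33*a^5*b^7 - 58*a^5*b^6*c - 51*a^5*b^6*d -
      16*a^5*b^5*c^2 - 16*a^5*b^5*c*d + 58*a^5*b^4*c^2*d + 63*a^4*b^8 + 14*a^4*b^7*c -
      18*a^4*b^7*d - 137*a^4*b^6*c^2 - 79*a^4*b^6*c*d - 58*a^4*b^5*c^2*d + 83*a^3*b^9 +
      84*a^3*b^8*c + 97*a^3*b^8*d - 142*a^3*b^7*c^2 + 6*a^3*b^7*c*d - 88*a^3*b^6*c^2*d +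
      61*a^2*b^10 + 64*a^2*b^9*c + 72*a^2*b^9*d - 87*a^2*b^8*c^2 + 11*a^2*b^8*c*d -
      68*a^2*b^7*c^2*d + 34*a*b^11 + 44*a*b^10*c + 50*a*b^10*d - 42*a*b^9*c^2 + 16*a*b^9*c*d -
      38*a*b^8*c^2*d + 8*b^12 + 16*b^11*c + 24*b^11*d - 8*b^10*c^2 + 16*b^10*c*d - 8*b^9*c^2*d := by
    linear_combination t * dd + (-8*a^10 - 18*a^9*b + 8*a^9*d - 29*a^8*b^2 + 8*a^8*b*c + 22*a^8*b*d + 8*a^8*c^2 + 16*a^8*c*d - 44*a^7*b^3 + 14*a^7*b^2*c + 40*a^7*b^2*d + 22*a^7*b*c^2 + 44*a^7*b*c*d + 24*a^7*c^2*d - 13*a^6*b^4 + 18*a^6*b^3*c + 52*a^6*b^3*d + 32*a^6*b^2*c^2 + 64*a^6*b^2*c*d + 42*a^6*b*c^2*d + 20*a^5*b^4*c + 18*a^5*b^4*d + 38*a^5*b^3*c^2 + 76*a^5*b^3*c*d + 54*a^5*b^2*c^2*d + 13*a^4*b^6 - 20*a^4*b^5*c - 18*a^4*b^5*d + 60*a^4*b^3*c^2*d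 + 44*a^3*b^7 - 18*a^3*b^6*c - 52*a^3*b^6*d - 38*a^3*b^5*c^2 - 76*a^3*b^5*c*d - 60*a^3*b^4*c^2*d + 29*a^2*b^8 - 14*a^2*b^7*c - 40*a^2*b^7*d - 32*a^2*b^6*c^2 - 64*a^2*b^6*c*d - 54*a^2*b^5*c^2*d + 18*a*b^9 - 8*a*b^8*c - 22*a*b^8*d - 22*a*b^7*c^2 - 44*a*b^7*c*d - 42*a*b^6*c^2*d + 8*b^10 - 8*b^9*d - 8*b^8*c^2 - 16*b^8*c*d - 24*b^7*c^2*d) * t1 +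
      (-8*a^10 - 22*a^9*b - 8*a^9*c - 40*a^8*b^2 - 22*a^8*b*c - 8*a^8*c^2 - 52*a^7*b^3 -
      24*a^7*b^2*c + 2*a^7*b*c^2 + 24*a^7*c^3 - 18*a^6*b^4 - 24*a^6*b^3*c + 10*a^6*b^2*c^2 +
      42*a^6*b*c^3 + 18*a^5*b^5 + 18*a^5*b^4*c + 16*a^5*b^3*c^2 + 54*a^5*b^2*c^3 + 52*a^4*b^6 +
      58*a^4*b^5*c + 60*a^4*b^4*c^2 + 60*a^4*b^3*c^3 + 40*a^3*b^7 + 12*a^3*b^6*c -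
      22*a^3*b^5*c^2 - 60*a^3*b^4*c^3 + 22*a^2*b^8 + 4*a^2*b^7*c - 22*a^2*b^6*c^2 -
      54*a^2*b^5*c^3 + 8*a*b^9 - 6*a*b^8*c - 20*a*b^7*c^2 - 42*a*b^6*c^3 - 8*b^9*c - 16*b^8*c^2
      - 24*b^7*c^3) * r1 +
      (16*a^8*b + 16*a^8*c + 8*a^8*d + 28*a^7*b^2 + 20*a^7*b*c + 46*a^7*b*d - 24*a^7*c^2 +
      36*a^6*b^3 + 22*a^6*b^2*c + 74*a^6*b^2*d - 42*a^6*b*c^2 + 40*a^5*b^4 + 22*a^5*b^3*c +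
      92*a^5*b^3*d - 54*a^5*b^2*c^2 - 40*a^4*b^5 - 60*a^4*b^4*c + 60*a^4*b^4*d - 60*a^4*b^3*c^2
      - 36*a^3*b^6 - 16*a^3*b^5*c - 98*a^3*b^5*d + 60*a^3*b^4*c^2 - 28*a^2*b^7 - 10*a^2*b^6*c -
      86*a^2*b^6*d + 54*a^2*b^5*c^2 - 16*a*b^8 - 2*a*b^7*c - 64*a*b^7*d + 42*a*b^6*c^2 + 8*b^8*c
      - 32*b^8*d + 24*b^7*c^2) * r2
  have y1 : E*(E^2 - t^4 + 3*E*t^2) =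
      -10*a^12 - 31*a^11*b + 6*a^11*d - 71*a^10*b^2 - 6*a^10*b*c + 14*a^10*b*d - 7*a^10*c^2 -
      126*a^9*b^3 - 23*a^9*b^2*c + 26*a^9*b^2*d - 16*a^9*b*c^2 + 3*a^9*b*c*d + 6*a^9*c^2*d -
      196*a^8*b^4 - 63*a^8*b^3*c + 21*a^8*b^3*d - 31*a^8*b^2*c^2 + 8*a^8*b^2*c*d +
      16*a^8*b*c^2*d - 246*a^7*b^5 - 123*a^7*b^4*c - 4*a^7*b^4*d - 66*a^7*b^3*c^2 -
      27*a^7*b^3*c*d + 26*a^7*b^2*c^2*d - 259*a^6*b^6 - 158*a^6*b^5*c - 31*a^6*b^5*d -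
      81*a^6*b^4*c^2 - 62*a^6*b^4*c*d + 16*a^6*b^3*c^2*d - 244*a^5*b^7 - 181*a^5*b^6*c -
      57*a^5*b^6*d - 87*a^5*b^5*c^2 - 87*a^5*b^5*c*d + 6*a^5*b^4*c^2*d - 199*a^4*b^8 -
      177*a^4*b^7*c - 76*a^4*b^7*d - 84*a^4*b^6*c^2 - 103*a^4*b^6*c*d - 6*a^4*b^5*c^2*d -
      129*a^3*b^9 - 137*a^3*b^8*c - 71*a^3*b^8*d - 69*a^3*b^7*c^2 - 108*a^3*b^7*c*d -
      16*a^3*b^6*c^2*d - 69*a^2*b^10 - 77*a^2*b^9*c - 46*a^2*b^9*d - 34*a^2*b^8*c^2 -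
      73*a^2*b^8*c*d - 26*a^2*b^7*c^2*d - 35*a*b^11 - 42*a*b^10*c - 25*a*b^10*d - 19*a*b^9*c^2 -
      38*a*b^9*c*d - 16*a*b^8*c^2*d - 10*b^12 - 13*b^11*c - 7*b^11*d - 6*b^10*c^2 - 13*b^10*c*d
      - 6*b^9*c^2*d := by
    linear_combination (E^2 - t^4 + 3*E*t^2) * k1 + (-a^4 - a^3*b - a^2*b^2 - a*b^3 - b^4) * u1 +
      (0) * r1 +
      (0) * r2
  linear_combination w1 - x1 + 5 * y1

theorem sextic_root {L : Type*} [Field L] [CharZero L] (t : L)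
    (h : t^6 - 100*t^4 + 6000*t^2 - 32000*t + 40000 = 0) :
    ∃ x : L, x^6 + 2*x^5 + 5*x^4 + 10*x^3 + 10*x^2 + 8*x + 1 = 0 := by
  obtain ⟨x, x1⟩ : ∃ x : L, x = (-3/4)*t^0 + (1/2)*t^1 + (-3/40)*t^2 + (-1/80)*t^3 + (1/1600)*t^4 + (1/8000)*t^5 := ⟨_, rfl⟩
  refine ⟨x, ?_⟩
  have x2 : x^2 = (3/2)*t^0 + (-3/4)*t^1 + (-1/20)*t^2 + (1/80)*t^3 + (1/800)*t^4 := by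
    linear_combination (x + ((-3/4)*t^0 + (1/2)*t^1 + (-3/40)*t^2 + (-1/80)*t^3 + (1/1600)*t^4 + (1/8000)*t^5)) * x1 + ((-3/128000)*t^0 + (-3/160000)*t^1 + (-3/2560000)*t^2 + (1/6400000)*t^3 + (1/64000000)*t^4) * h
  have x3 : x^3 = (9/2)*t^0 + (-13/4)*t^1 + (7/20)*t^2 + (1/16)*t^3 + (-3/800)*t^4 + (-3/4000)*t^5 := by
    linear_combination x^2 * x1 + ((-3/4)*t^0 + (1/2)*t^1 + (-3/40)*t^2 + (-1/80)*t^3 + (1/1600)*t^4 + (1/8000)*t^5) * x2 + ((-9/64000)*t^0 + (1/640000)*t^1 + (3/1280000)*t^2 + (1/6400000)*t^3) * h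
  have x4 : x^4 = (-21/4)*t^0 + (5/2)*t^1 + (9/40)*t^2 + (-1/40)*t^3 + (-1/320)*t^4 := by
    linear_combination x^3 * x1 + ((-3/4)*t^0 + (1/2)*t^1 + (-3/40)*t^2 + (-1/80)*t^3 + (1/1600)*t^4 + (1/8000)*t^5) * x3 + ((3/64000)*t^0 + (59/640000)*t^1 + (7/1280000)*t^2 + (-3/3200000)*t^3 + (-3/32000000)*t^4) * h
  have x5 : x^5 = (-63/4)*t^0 + (43/4)*t^1 + (-7/8)*t^2 + (-17/80)*t^3 + (9/1600)*t^4 + (1/500)*t^5 := by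
    linear_combination x^4 * x1 + ((-3/4)*t^0 + (1/2)*t^1 + (-3/40)*t^2 + (-1/80)*t^3 + (1/1600)*t^4 + (1/8000)*t^5) * x4 + ((63/128000)*t^0 + (1/80000)*t^1 + (-13/2560000)*t^2 + (-1/2560000)*t^3) * h
  have x6 : x^6 = (11/4)*t^0 + (2)*t^1 + (-71/40)*t^2 + (-1/10)*t^3 + (39/1600)*t^4 + (1/400)*t^5 := by
    linear_combination x^5 * x1 + ((-3/4)*t^0 + (1/2)*t^1 + (-3/40)*t^2 + (-1/80)*t^3 + (1/1600)*t^4 + (1/8000)*t^5) * x5 + ((29/128000)*t^0 + (-171/640000)*t^1 + (-59/2560000)*t^2 + (1/512000)*t^3 + (1/4000000)*t^4) * h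
  linear_combination x6 + 2*x5 + 5*x4 + 10*x3 + 10*x2 + 8*x1

theorem natDegree_dvd_card_gal {p : ℚ[X]} (p_irr : Irreducible p) :
    p.natDegree ∣ Nat.card p.Gal := by
  rw [Gal.card_of_separable p_irr.separable]
  have hp : p.degree ≠ 0 := fun h => p_irr.natDegree_pos.ne'
    (natDegree_eq_zero_iff_degree_le_zero.mpr (le_of_eq h))
  let α : p.SplittingField :=
    rootOfSplits (SplittingField.splits p) (by rwa [degree_map])
  have hα : IsIntegral ℚ α := .of_finite ℚ α
  have hr : aeval α p = 0 := by
    rw [← eval_map_algebraMap]; exact eval_rootOfSplits _ _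
  have hd : (minpoly ℚ α).natDegree = p.natDegree := by
    have h1 : minpoly ℚ α ∣ p := minpoly.dvd ℚ α hr
    have key := (minpoly.irreducible hα).dvd_symm p_irr h1
    exact le_antisymm (natDegree_le_of_dvd h1 p_irr.ne_zero)
      (natDegree_le_of_dvd key (minpoly.ne_zero hα))
  refine ⟨Module.finrank (IntermediateField.adjoin ℚ {α}) p.SplittingField, ?_⟩
  rw [← hd, ← IntermediateField.adjoin.finrank hα]
  exact (Module.finrank_mul_finrank ℚ (IntermediateField.adjoin ℚ {α}) p.SplittingField).symm

/-- A variant of the Eisenstein criterion. -/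
theorem factor_degree (F g k : ℤ[X]) (hg : g.Monic)
    (hF : F.map (Int.castRingHom (ZMod 5)) = X ^ 5 * (X - 1))
    (hgk : g * k = F) (h0 : ¬ (5 : ℤ) ∣ g.coeff 0) : g.natDegree ≤ 1 := by
  have : Fact (Nat.Prime 5) := ⟨by norm_num⟩
  set φ := Int.castRingHom (ZMod 5)
  have h1 : g.map φ * k.map φ = X ^ 5 * (X - 1) := by rw [← Polynomial.map_mul, hgk, hF]
  have h2 : ¬ (X : (ZMod 5)[X]) ∣ g.map φ := by
    rw [X_dvd_iff, coeff_map]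
    intro h
    exact h0 (by exact_mod_cast (ZMod.intCast_zmod_eq_zero_iff_dvd _ 5).mp h)
  have h3 : IsCoprime (g.map φ) (X ^ 5) :=
    ((irreducible_X.coprime_iff_not_dvd.mpr h2).pow_left).symm
  have h4 : g.map φ ∣ X - 1 := h3.dvd_of_dvd_mul_left ⟨_, h1.symm⟩
  have h5 : (X - 1 : (ZMod 5)[X]) = X - C 1 := by simp
  have h6 := natDegree_le_of_dvd h4 (by rw [h5]; exact X_sub_C_ne_zero _)
  rwa [h5, natDegree_X_sub_C, hg.natDegree_map] at h6


theorem sextic_irreducible :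
    Irreducible (X ^ 6 + 2 * X ^ 5 + 5 * X ^ 4 + 10 * X ^ 3 + 10 * X ^ 2 + 8 * X + 1 : ℚ[X]) := by
  have hm : (X ^ 6 + 2 * X ^ 5 + 5 * X ^ 4 + 10 * X ^ 3 + 10 * X ^ 2 + 8 * X + 1 : ℤ[X]).Monic := by
    monicity!
  have hd : (X ^ 6 + 2 * X ^ 5 + 5 * X ^ 4 + 10 * X ^ 3 + 10 * X ^ 2 + 8 * X + 1 : ℤ[X]).natDegree = 6 := by
    compute_degree!
  have key : Irreducible
      (X ^ 6 + 2 * X ^ 5 + 5 * X ^ 4 + 10 * X ^ 3 + 10 * X ^ 2 + 8 * X + 1 : ℤ[X]) := by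
    set F := (X ^ 6 + 2 * X ^ 5 + 5 * X ^ 4 + 10 * X ^ 3 + 10 * X ^ 2 + 8 * X + 1 : ℤ[X]) with hF
    -- no monic linear factors
    have hlin : ∀ g : ℤ[X], g.Monic → g ∣ F → g.natDegree ≠ 1 := by
      rintro g hg hgF h1
      have hgC : g = X + C (g.coeff 0) := hg.eq_X_add_C h1
      have hr : F.eval (-(g.coeff 0)) = 0 := by
        obtain ⟨k, hk⟩ := hgF
        rw [hk, eval_mul]
        conv_lhs => rw [hgC]
        simp
      generalize -(g.coeff 0) = r at hr
      simp only [hF, eval_add, eval_mul, eval_pow, eval_X, eval_ofNat, eval_one] at hr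
      have hu : r ∣ 1 := ⟨-(r^5 + 2*r^4 + 5*r^3 + 10*r^2 + 10*r + 8), by linear_combination hr⟩
      rcases Int.isUnit_iff.mp (isUnit_of_dvd_one hu) with rfl | rfl <;> norm_num at hr
    have hmap : (F.comp (X + 2)).map (Int.castRingHom (ZMod 5)) = X ^ 5 * (X - 1) := by
      have e1 : F.comp (X + 2) =
          X ^ 5 * (X - 1) + C 5 * (3 * X ^ 5 + 17 * X ^ 4 + 58 * X ^ 3 + 118 * X ^ 2 + 136 * X + 69) := by
        simp only [hF, add_comp, mul_comp, pow_comp, X_comp, ofNat_comp, one_comp, map_ofNat]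
        ring
      rw [e1, Polynomial.map_add, Polynomial.map_mul _ (p := C 5), map_C]
      have : (Int.castRingHom (ZMod 5)) 5 = 0 := by decide
      rw [this]
      simp
    have hdeg : ∀ g k : ℤ[X], g.Monic → g * k = F → ¬ (5 : ℤ) ∣ g.eval 2 → g.natDegree ≤ 1 := by
      intro g k hg hgk h5
      have h2 : (X + 2 : ℤ[X]) = X + C 2 := by simp
      have := factor_degree (F.comp (X + 2)) (g.comp (X + 2)) (k.comp (X + 2))
        (by rw [h2]; exact hg.comp_X_add_C 2) hmap (by rw [← mul_comp, hgk])
        (by rw [coeff_zero_eq_eval_zero, eval_comp]; simpa using h5)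
      rwa [natDegree_comp, h2, natDegree_X_add_C, mul_one] at this
    rw [hm.irreducible_iff_natDegree]
    refine ⟨fun h => by rw [h] at hd; simp at hd, ?_⟩
    intro g k hg hk hgk
    have hev : g.eval 2 * k.eval 2 = 345 := by
      rw [← eval_mul, hgk, hF]; norm_num
    have h5 : ¬ (5 : ℤ) ∣ g.eval 2 ∨ ¬ (5 : ℤ) ∣ k.eval 2 := by
      by_contra! hcon
      have := mul_dvd_mul hcon.1 hcon.2
      rw [hev] at this
      norm_num at this
    rcases h5 with h5 | h5
    · left
      have := hdeg g k hg hgk h5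
      have := hlin g hg ⟨k, hgk.symm⟩
      omega
    · right
      have := hdeg k g hk (by rw [mul_comm, hgk]) h5
      have := hlin k hk ⟨g, by rw [mul_comm, hgk]⟩
      omega
  have := (hm.irreducible_iff_irreducible_map_fraction_map (K := ℚ)).mp key
  simpa using this

theorem quintic_irreducible : Irreducible (X ^ 5 + 20 * X - 16 : ℚ[X]) := by
  have hm : (X ^ 5 + 20 * X - 16 : ℤ[X]).Monic := by monicity!
  have hm' : (X ^ 5 + 5 * X ^ 4 + 10 * X ^ 3 + 10 * X ^ 2 + 25 * X + 5 : ℤ[X]).Monic := by monicity!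
  have hd' : (X ^ 5 + 5 * X ^ 4 + 10 * X ^ 3 + 10 * X ^ 2 + 25 * X + 5 : ℤ[X]).degree = 5 := by
    compute_degree!
  have key' : Irreducible
      (X ^ 5 + 5 * X ^ 4 + 10 * X ^ 3 + 10 * X ^ 2 + 25 * X + 5 : ℤ[X]) := by
    apply irreducible_of_eisenstein_criterion (P := Ideal.span {(5 : ℤ)})
    · exact (Ideal.span_singleton_prime (by norm_num)).mpr (by norm_num)
    · rw [hm'.leadingCoeff, Ideal.mem_span_singleton]; norm_num
    · intro n hn
      rw [hd'] at hn
      have hn : n < 5 := by exact_mod_cast hn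
      rw [Ideal.mem_span_singleton]
      interval_cases n <;> simp [coeff_X, coeff_ofNat_mul, coeff_X_pow]
    · rw [hd']; norm_num
    · rw [Ideal.span_singleton_pow, Ideal.mem_span_singleton]
      simp [coeff_X, coeff_ofNat_mul]
    · exact hm'.isPrimitive
  have e : taylorEquiv (1 : ℤ) (X ^ 5 + 20 * X - 16 : ℤ[X]) =
      X ^ 5 + 5 * X ^ 4 + 10 * X ^ 3 + 10 * X ^ 2 + 25 * X + 5 := by
    simp [taylorEquiv, taylor_apply]
    ring
  have key : Irreducible (X ^ 5 + 20 * X - 16 : ℤ[X]) := by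
    rw [← MulEquiv.irreducible_iff (taylorEquiv (1 : ℤ)), e]
    exact key'
  have := (hm.irreducible_iff_irreducible_map_fraction_map (K := ℚ)).mp key
  simpa using this

theorem group_lemma {G : Type*} [Group G] (ψ : G →* alternatingGroup (Fin 5))
    (hψ : Function.Injective ψ) (h : 30 ∣ Nat.card G) : Function.Bijective ψ := by
  have : IsSimpleGroup (alternatingGroup (Fin 5)) := alternatingGroup.isSimpleGroup (by simp)
  have hA : Nat.card (alternatingGroup (Fin 5)) = 60 := by
    rw [nat_card_alternatingGroup]; simp [Nat.factorial]
  have hc : Nat.card ψ.range = Nat.card G := Nat.card_congr (ψ.ofInjective hψ).toEquiv.symm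
  have hi := ψ.range.card_mul_index
  rw [hA, hc] at hi
  refine ⟨hψ, ?_⟩
  rw [← MonoidHom.range_eq_top]
  obtain ⟨k, hk⟩ := h
  have hki : k * ψ.range.index = 2 := by
    rw [hk] at hi; linarith
  have hcase : ψ.range.index = 1 ∨ ψ.range.index = 2 :=
    (Nat.dvd_prime Nat.prime_two).mp ⟨k, by linarith⟩
  rcases hcase with h1 | h2
  · exact Subgroup.index_eq_one.mp h1
  · have := Subgroup.normal_of_index_eq_two h2
    rcases Subgroup.Normal.eq_bot_or_eq_top this with h | h
    · rw [h, Subgroup.index_bot, hA] at h2; norm_num at h2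
    · exact h

theorem vandermonde_sq {L : Type*} [Field L] (y : Fin 5 → L)
    (hy : ∀ i, y i ^ 5 = 16 - 20 * y i)
    (e1 : y 0 + y 1 + y 2 + y 3 + y 4 = 0)
    (p2 : y 0 ^ 2 + y 1 ^ 2 + y 2 ^ 2 + y 3 ^ 2 + y 4 ^ 2 = 0)
    (p3 : y 0 ^ 3 + y 1 ^ 3 + y 2 ^ 3 + y 3 ^ 3 + y 4 ^ 3 = 0)
    (p4 : y 0 ^ 4 + y 1 ^ 4 + y 2 ^ 4 + y 3 ^ 4 + y 4 ^ 4 = -80) :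
    (Matrix.vandermonde y).det ^ 2 = 32000 ^ 2 := by
  have h5 : ∀ k, ∑ i, y i ^ (k + 5) = 16 * ∑ i, y i ^ k - 20 * ∑ i, y i ^ (k + 1) := by
    intro k
    rw [Finset.mul_sum, Finset.mul_sum, ← Finset.sum_sub_distrib]
    refine Finset.sum_congr rfl fun i _ => ?_
    rw [pow_add, hy]; ring
  have s0 : ∑ i, y i ^ 0 = 5 := by simp
  have s1 : ∑ i, y i ^ 1 = 0 := by simpa [Fin.sum_univ_five] using e1
  have s2 : ∑ i, y i ^ 2 = 0 := by simpa [Fin.sum_univ_five] using p2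
  have s3 : ∑ i, y i ^ 3 = 0 := by simpa [Fin.sum_univ_five] using p3
  have s4 : ∑ i, y i ^ 4 = -80 := by simpa [Fin.sum_univ_five] using p4
  have s5 : ∑ i, y i ^ 5 = 80 := by rw [h5 0, s0, s1]; norm_num
  have s6 : ∑ i, y i ^ 6 = 0 := by rw [h5 1, s1, s2]; norm_num
  have s7 : ∑ i, y i ^ 7 = 0 := by rw [h5 2, s2, s3]; norm_num
  have s8 : ∑ i, y i ^ 8 = 1600 := by rw [h5 3, s3, s4]; norm_num
  have hM : (Matrix.vandermonde y).transpose * Matrix.vandermonde y =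
      !![5, 0, 0, 0, -80; 0, 0, 0, -80, 80; 0, 0, -80, 80, 0; 0, -80, 80, 0, 0;
        -80, 80, 0, 0, 1600] := by
    ext i j
    rw [Matrix.vandermonde_transpose_mul_vandermonde]
    have s1' : ∑ i, y i = 0 := by simpa using s1
    fin_cases i <;> fin_cases j <;> simp [s1', s2, s3, s4, s5, s6, s7, s8]
  rw [sq, ← Matrix.det_transpose (Matrix.vandermonde y)]
  nth_rw 2 [Matrix.det_transpose]
  rw [← Matrix.det_mul, hM]
  simp [Matrix.det_succ_row_zero, Fin.sum_univ_succ, Fin.succAbove]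
  norm_num

theorem exists_roots {L : Type*} [Field L] [Algebra ℚ L]
    (hs : ((X ^ 5 + 20 * X - 16 : ℚ[X]).map (algebraMap ℚ L)).Splits) :
    ∃ y : Fin 5 → L, (X ^ 5 + 20 * X - 16 : L[X]) =
      (X - C (y 0)) * (X - C (y 1)) * (X - C (y 2)) * (X - C (y 3)) * (X - C (y 4)) := by
  have hm : (X ^ 5 + 20 * X - 16 : L[X]).Monic := by monicity!
  have hd : (X ^ 5 + 20 * X - 16 : L[X]).natDegree = 5 := by compute_degree!
  have e : ((X ^ 5 + 20 * X - 16 : ℚ[X]).map (algebraMap ℚ L)) = X ^ 5 + 20 * X - 16 := by simp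
  rw [e] at hs
  have h1 := hs.eq_prod_roots
  have h2 := hs.natDegree_eq_card_roots
  rw [hm.leadingCoeff] at h1
  rw [hd] at h2
  obtain ⟨l, hl⟩ := Quot.exists_rep (X ^ 5 + 20 * X - 16 : L[X]).roots
  rw [← hl] at h1 h2
  match l, h2, h1 with
  | [a, b, c, d, e], _, h1 =>
    refine ⟨![a, b, c, d, e], ?_⟩
    rw [h1]
    simp [mul_assoc]

theorem root_relations {L : Type*} [Field L] (a b c d e : L)
    (h : (X ^ 5 + 20 * X - 16 : L[X]) =
      (X - C a) * (X - C b) * (X - C c) * (X - C d) * (X - C e)) :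
    e = -(a+b+c+d) ∧ a*b+a*c+a*d+a*e+b*c+b*d+b*e+c*d+c*e+d*e = 0 ∧
    a*b*c+a*b*d+a*b*e+a*c*d+a*c*e+a*d*e+b*c*d+b*c*e+b*d*e+c*d*e = 0 ∧
    20 = a*b*c*d+a*b*c*e+a*b*d*e+a*c*d*e+b*c*d*e := by
  have h' : (X ^ 5 + 20 * X - 16 : L[X]) = X^5 - C (a+b+c+d+e) * X^4
    + C (a*b+a*c+a*d+a*e+b*c+b*d+b*e+c*d+c*e+d*e) * X^3
    - C (a*b*c+a*b*d+a*b*e+a*c*d+a*c*e+a*d*e+b*c*d+b*c*e+b*d*e+c*d*e) * X^2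
    + C (a*b*c*d+a*b*c*e+a*b*d*e+a*c*d*e+b*c*d*e) * X - C (a*b*c*d*e) := by
    rw [h]; simp only [map_add, map_mul]; ring
  have c4 := congrArg (fun p => coeff p 4) h'
  have c3 := congrArg (fun p => coeff p 3) h'
  have c2 := congrArg (fun p => coeff p 2) h'
  have c1 := congrArg (fun p => coeff p 1) h'
  simp only [coeff_add, coeff_sub, coeff_C_mul, coeff_X_pow, coeff_X, coeff_C, coeff_ofNat_mul,
    coeff_ofNat_succ] at c4 c3 c2 c1
  norm_num [coeff_ofNat_succ] at c4 c3 c2 c1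
  refine ⟨?_, ?_, ?_, ?_⟩
  · linear_combination c4
  · linear_combination -c3
  · linear_combination c2
  · linear_combination c1

theorem newton_relations {L : Type*} [Field L] (a b c d e : L)
    (h1 : e = -(a+b+c+d)) (h2 : a*b+a*c+a*d+a*e+b*c+b*d+b*e+c*d+c*e+d*e = 0)
    (h3 : a*b*c+a*b*d+a*b*e+a*c*d+a*c*e+a*d*e+b*c*d+b*c*e+b*d*e+c*d*e = 0)
    (h4 : 20 = a*b*c*d+a*b*c*e+a*b*d*e+a*c*d*e+b*c*d*e) :
    a^2+b^2+c^2+d^2+e^2 = 0 ∧ a^3+b^3+c^3+d^3+e^3 = 0 ∧ a^4+b^4+c^4+d^4+e^4 = -80 ∧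
    a^2 + a*b + a*c + a*d + b^2 + b*c + b*d + c^2 + c*d + d^2 = 0 ∧
    a^3 + a^2*b + a^2*c + a*b^2 + a*b*c + a*c^2 + b^3 + b^2*c + b*c^2 + c^3 = 0 := by
  have q1 : a+b+c+d+e = 0 := by rw [h1]; ring
  have r1 : a^2 + a*b + a*c + a*d + b^2 + b*c + b*d + c^2 + c*d + d^2 = 0 := by
    subst h1; linear_combination -h2
  refine ⟨?_, ?_, ?_, r1, ?_⟩
  · linear_combination (a+b+c+d+e) * q1 - 2 * h2
  · linear_combination (a+b+c+d+e)^2 * q1 - 3 * (a+b+c+d+e) * h2 + 3 * h3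
  · linear_combination (a+b+c+d+e)^3 * q1 - 4 * (a+b+c+d+e)^2 * h2 + 2 *
      (a*b+a*c+a*d+a*e+b*c+b*d+b*e+c*d+c*e+d*e) * h2 + 4 * (a+b+c+d+e) * h3 + 4 * h4
  · subst h1; linear_combination h3 + (a+b+c) * r1

theorem exists_roots_pos {L : Type*} [Field L] [CharZero L] [Algebra ℚ L]
    (hs : ((X ^ 5 + 20 * X - 16 : ℚ[X]).map (algebraMap ℚ L)).Splits) :
    ∃ y : Fin 5 → L, (X ^ 5 + 20 * X - 16 : L[X]) =
      (X - C (y 0)) * (X - C (y 1)) * (X - C (y 2)) * (X - C (y 3)) * (X - C (y 4)) ∧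
      (Matrix.vandermonde y).det = 32000 := by
  obtain ⟨y, hy⟩ := exists_roots hs
  have hroot : ∀ i, y i ^ 5 = 16 - 20 * y i := by
    intro i
    have := congrArg (eval (y i)) hy
    have h0 : eval (y i) ((X - C (y 0)) * (X - C (y 1)) * (X - C (y 2)) * (X - C (y 3)) *
        (X - C (y 4))) = 0 := by
      fin_cases i <;> simp
    rw [h0] at this
    simp at this
    linear_combination this
  obtain ⟨h1, h2, h3, h4⟩ := root_relations _ _ _ _ _ hy
  obtain ⟨n2, n3, n4, -, -⟩ := newton_relations _ _ _ _ _ h1 h2 h3 h4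
  have hsq := vandermonde_sq y hroot (by rw [h1]; ring) n2 n3 n4
  rcases sq_eq_sq_iff_eq_or_eq_neg.mp hsq with h | h
  · exact ⟨y, hy, h⟩
  · refine ⟨y ∘ Equiv.swap 0 1, ?_, ?_⟩
    · have s2 : Equiv.swap (0 : Fin 5) 1 2 = 2 := by decide
      have s3 : Equiv.swap (0 : Fin 5) 1 3 = 3 := by decide
      have s4 : Equiv.swap (0 : Fin 5) 1 4 = 4 := by decide
      simp only [Function.comp, Equiv.swap_apply_left, Equiv.swap_apply_right, s2, s3, s4]
      rw [hy]; ring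
    · have hv : Matrix.vandermonde (y ∘ Equiv.swap 0 1) =
          (Matrix.vandermonde y).submatrix (Equiv.swap 0 1) id := by
        ext i j; simp [Matrix.vandermonde_apply]
      rw [hv, Matrix.det_permute, h, Equiv.Perm.sign_swap (by decide)]
      simp

theorem sextic_has_root {L : Type*} [Field L] [CharZero L] (y : Fin 5 → L)
    (hy : (X ^ 5 + 20 * X - 16 : L[X]) =
      (X - C (y 0)) * (X - C (y 1)) * (X - C (y 2)) * (X - C (y 3)) * (X - C (y 4)))
    (hdet : (Matrix.vandermonde y).det = 32000) :
    ∃ x : L, x^6 + 2*x^5 + 5*x^4 + 10*x^3 + 10*x^2 + 8*x + 1 = 0 := by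
  obtain ⟨h1, h2, h3, h4⟩ := root_relations _ _ _ _ _ hy
  obtain ⟨-, -, -, r1, r2⟩ := newton_relations _ _ _ _ _ h1 h2 h3 h4
  rw [Matrix.det_vandermonde] at hdet
  have i0 : Finset.Ioi (0 : Fin 5) = {1, 2, 3, 4} := by decide
  have i1 : Finset.Ioi (1 : Fin 5) = {2, 3, 4} := by decide
  have i2 : Finset.Ioi (2 : Fin 5) = {3, 4} := by decide
  have i3 : Finset.Ioi (3 : Fin 5) = {4} := by decide
  have i4 : Finset.Ioi (4 : Fin 5) = ∅ := by decide
  rw [Fin.prod_univ_five, i0, i1, i2, i3, i4] at hdet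
  simp at hdet
  have hD := resolvent_relation (y 0) (y 1) (y 2) (y 3) (y 4) 20 _ _ _ 32000 _ h1 r1 r2 h4 rfl rfl rfl
    (by rw [← hdet]; simp only [mul_assoc, mul_comm, mul_left_comm]) rfl
  refine sextic_root (y 0 * y 1 + y 1 * y 2 + y 2 * y 3 + y 3 * y 4 + y 4 * y 0) ?_
  linear_combination hD

theorem aeval_quintic {L : Type*} [Field L] [Algebra ℚ L] (x : L) :
    aeval x (X ^ 5 + 20 * X - 16 : ℚ[X]) = x ^ 5 + 20 * x - 16 := by
  simp [map_ofNat (aeval x : ℚ[X] →ₐ[ℚ] L)]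

theorem aeval_sextic {L : Type*} [Field L] [Algebra ℚ L] (x : L) :
    aeval x (X ^ 6 + 2 * X ^ 5 + 5 * X ^ 4 + 10 * X ^ 3 + 10 * X ^ 2 + 8 * X + 1 : ℚ[X]) =
      x^6 + 2*x^5 + 5*x^4 + 10*x^3 + 10*x^2 + 8*x + 1 := by
  simp [map_ofNat (aeval x : ℚ[X] →ₐ[ℚ] L)]

theorem aut_quintic {L : Type*} [Field L] [Algebra ℚ L] (g : L ≃ₐ[ℚ] L) (x : L)
    (hx : x ^ 5 + 20 * x - 16 = 0) : (g x) ^ 5 + 20 * (g x) - 16 = 0 := by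
  have := congrArg g hx
  simpa [map_ofNat g] using this

theorem aut_number {L : Type*} [Field L] [Algebra ℚ L] (g : L ≃ₐ[ℚ] L) :
    g 32000 = 32000 :=
  map_ofNat g 32000

theorem exists_hom : ∃ ψ : (X ^ 5 + 20 * X - 16 : ℚ[X]).Gal →* alternatingGroup (Fin 5),
    Function.Injective ψ := by
  set h : ℚ[X] := X ^ 5 + 20 * X - 16 with hh
  have hc : CharZero h.SplittingField := algebraRat.charZero _
  obtain ⟨y, hy, hdet⟩ := exists_roots_pos (L := h.SplittingField) (SplittingField.splits h)
  have hinj : Function.Injective y := by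
    rw [← Matrix.det_vandermonde_ne_zero_iff, hdet]; norm_num
  have hroot : ∀ z : h.SplittingField, z ^ 5 + 20 * z - 16 = 0 ↔ ∃ i, z = y i := by
    intro z
    have := congrArg (eval z) hy
    simp only [eval_sub, eval_add, eval_mul, eval_pow, eval_X, eval_C, eval_ofNat] at this
    rw [this]
    simp [sub_eq_zero, Fin.exists_fin_succ, or_assoc]
  have hex : ∀ (g : h.Gal) (i : Fin 5), ∃ j, g (y i) = y j := by
    intro g i
    rw [← hroot]
    exact aut_quintic g (y i) ((hroot (y i)).mpr ⟨i, rfl⟩)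
  choose j hj using hex
  have hjinj : ∀ g, Function.Injective (j g) := by
    intro g a b hab
    have : g (y a) = g (y b) := by rw [hj, hj, hab]
    exact hinj (g.injective this)
  let π : h.Gal → Equiv.Perm (Fin 5) := fun g =>
    Equiv.ofBijective (j g) (Finite.injective_iff_bijective.mp (hjinj g))
  have hπ : ∀ g i, y (π g i) = g (y i) := fun g i => (hj g i).symm
  have hsign : ∀ g, π g ∈ alternatingGroup (Fin 5) := by
    intro g
    rw [Equiv.Perm.mem_alternatingGroup]
    have e1 : (Matrix.vandermonde y).submatrix (π g) id =
        (g : h.SplittingField →+* h.SplittingField).mapMatrix (Matrix.vandermonde y) := by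
      ext a b
      simp [Matrix.vandermonde_apply, hπ]
    have e2 := Matrix.det_permute (π g) (Matrix.vandermonde y)
    rw [e1, ← RingHom.map_det, hdet] at e2
    rcases Int.units_eq_one_or (Equiv.Perm.sign (π g)) with hs | hs
    · exact hs
    · rw [hs] at e2
      have e3 : (32000 : h.SplittingField) = ((-1 : ℤˣ) : ℤ) * 32000 :=
        (aut_number g).symm.trans e2
      norm_num at e3
  let ψ : h.Gal →* alternatingGroup (Fin 5) := MonoidHom.mk' (fun g => ⟨π g, hsign g⟩) (by
    intro a b
    apply Subtype.ext
    apply Equiv.ext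
    intro i
    apply hinj
    change y (π (a * b) i) = y (π a (π b i))
    rw [hπ, hπ, hπ]
    rfl)
  refine ⟨ψ, ?_⟩
  intro a b hab
  have hab' : π a = π b := congrArg Subtype.val hab
  apply Gal.ext
  intro x hx
  obtain ⟨i, rfl⟩ := (hroot x).mp (by
    exact (aeval_quintic x).symm.trans (mem_rootSet.mp hx).2)
  rw [← hπ, ← hπ, hab']

theorem exists_surj : ∃ r : (X ^ 5 + 20 * X - 16 : ℚ[X]).Gal →*
    (X ^ 6 + 2 * X ^ 5 + 5 * X ^ 4 + 10 * X ^ 3 + 10 * X ^ 2 + 8 * X + 1 : ℚ[X]).Gal,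
    Function.Surjective r := by
  have hirr := sextic_irreducible
  set f : ℚ[X] := X ^ 6 + 2 * X ^ 5 + 5 * X ^ 4 + 10 * X ^ 3 + 10 * X ^ 2 + 8 * X + 1 with hf
  set h : ℚ[X] := X ^ 5 + 20 * X - 16 with hh
  have hc : CharZero h.SplittingField := algebraRat.charZero _
  obtain ⟨y, hy, hdet⟩ := exists_roots_pos (L := h.SplittingField) (SplittingField.splits h)
  obtain ⟨x, hx⟩ := sextic_has_root y hy hdet
  have hx' : aeval x f = 0 := (aeval_sextic x).trans hx
  have hn : Normal ℚ h.SplittingField := SplittingField.instNormal h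
  have hsp : (f.map (algebraMap ℚ h.SplittingField)).Splits :=
    (hn.splits x).of_dvd (map_ne_zero (minpoly.ne_zero (hn.isIntegral x)))
      ((map_dvd_map' _).mpr ((minpoly.irreducible (hn.isIntegral x)).dvd_symm hirr
        (minpoly.dvd ℚ x hx')))
  have : Fact ((f.map (algebraMap ℚ h.SplittingField)).Splits) := ⟨hsp⟩
  exact ⟨Gal.restrict f h.SplittingField, Gal.restrict_surjective f h.SplittingField⟩

theorem galois_group_order_60_nonabelian :
    let f : ℚ[X] := X ^ 6 + 2 * X ^ 5 + 5 * X ^ 4 + 10 * X ^ 3 + 10 * X ^ 2 + 8 * X + 1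
    Nat.card f.Gal = 60 ∧ ¬ (∀ a b : f.Gal, a * b = b * a) := by
  intro f
  obtain ⟨ψ, hψ⟩ := exists_hom
  obtain ⟨r, hr⟩ := exists_surj
  have d6 : 6 ∣ Nat.card f.Gal := by
    have := natDegree_dvd_card_gal sextic_irreducible
    have hd : (X ^ 6 + 2 * X ^ 5 + 5 * X ^ 4 + 10 * X ^ 3 + 10 * X ^ 2 + 8 * X + 1 :
        ℚ[X]).natDegree = 6 := by compute_degree!
    rwa [hd] at this
  have d5 : 5 ∣ Nat.card (X ^ 5 + 20 * X - 16 : ℚ[X]).Gal := by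
    have := natDegree_dvd_card_gal quintic_irreducible
    have hd : (X ^ 5 + 20 * X - 16 : ℚ[X]).natDegree = 5 := by compute_degree!
    rwa [hd] at this
  have d6' := d6.trans (Subgroup.card_dvd_of_surjective r hr)
  have hb := group_lemma ψ hψ (by omega)
  have hA : Nat.card (alternatingGroup (Fin 5)) = 60 := by
    rw [nat_card_alternatingGroup]; simp [Nat.factorial]
  have hsim : IsSimpleGroup (alternatingGroup (Fin 5)) := alternatingGroup.isSimpleGroup (by simp)
  let Ψ := MulEquiv.ofBijective ψ hb
  let s : alternatingGroup (Fin 5) →* f.Gal := r.comp Ψ.symm.toMonoidHom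
  have hs : Function.Surjective s := hr.comp Ψ.symm.surjective
  have hsi : Function.Injective s := by
    rw [← MonoidHom.ker_eq_bot_iff]
    rcases Subgroup.Normal.eq_bot_or_eq_top (MonoidHom.normal_ker s) with h | h
    · exact h
    · exfalso
      have h1 : ∀ g : f.Gal, g = 1 := by
        intro g
        obtain ⟨z, rfl⟩ := hs g
        have : z ∈ s.ker := by rw [h]; trivial
        exact this
      have : Subsingleton f.Gal := ⟨fun a b => by rw [h1 a, h1 b]⟩
      have hc : Nat.card f.Gal = 1 := Nat.card_unique
      rw [hc] at d6
      norm_num at d6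
  refine ⟨?_, ?_⟩
  · rw [← hA]
    exact (Nat.card_congr (Equiv.ofBijective s ⟨hsi, hs⟩)).symm
  · intro hcomm
    have hcA : ∀ a b : alternatingGroup (Fin 5), a * b = b * a := by
      intro a b
      apply hsi
      rw [map_mul, map_mul, hcomm]
    have := hcA ⟨Equiv.swap 0 1 * Equiv.swap 1 2, by
      rw [Equiv.Perm.mem_alternatingGroup]; decide⟩
      ⟨Equiv.swap 0 1 * Equiv.swap 1 3, by
      rw [Equiv.Perm.mem_alternatingGroup]; decide⟩
    exact absurd (congrArg Subtype.val this) (by decide)
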